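/- Let O ⊆ ℝ^d be an open convex set, f : ℝ^d → ℝ^d differentiable on O with invertible Jacobian Df(u) at every u ∈ O, and u* ∈ O with f(u*) = 0. Let θ > 0 be a Lipschitz constant on O for u ↦ Df(u), θ̄ > 0 a Lipschitz constant on O for u ↦ Df(u)⁻¹ (operator norm), and ρ* := ‖Df(u*)⁻¹‖. Then for every u ∈ O with ‖u − u*‖ ≤ min(ρ*/θ̄, 1/(2·θ·ρ*)), the Newton step N(u) := u − Df(u)⁻¹ f(u) satisfies the contraction estimate ‖N(u) − u*‖ ≤ (1/2)·‖u − u*‖. -/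

import Mathlib

/-- First-order Taylor estimate with the sharp constant `θ / 2` along a segment in a convex set,
for a function whose derivative varies at most linearly from its value at `x`. -/
theorem norm_sub_sub_fderiv_le_of_lipschitz {E F : Type*}
    [NormedAddCommGroup E] [NormedSpace ℝ E] [NormedAddCommGroup F] [NormedSpace ℝ F]
    {s : Set E} (hs : Convex ℝ s) {f : E → F} (hf : ∀ z ∈ s, DifferentiableAt ℝ f z)
    {θ : ℝ} {x y : E} (hx : x ∈ s) (hy : y ∈ s)
    (hlip : ∀ z ∈ s, ‖fderiv ℝ f z - fderiv ℝ f x‖ ≤ θ * ‖z - x‖) :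
    ‖f y - f x - fderiv ℝ f x (y - x)‖ ≤ θ / 2 * ‖y - x‖ ^ 2 := by
  set w := y - x with hw
  have hmem : ∀ t ∈ Set.Icc (0 : ℝ) 1, x + t • w ∈ s := fun t ht =>
    hs.add_smul_sub_mem hx hy ht
  have hderiv : ∀ t ∈ Set.Icc (0 : ℝ) 1,
      HasDerivAt (fun t : ℝ => f (x + t • w) - f x - t • fderiv ℝ f x w)
        (fderiv ℝ f (x + t • w) w - fderiv ℝ f x w) t := by
    intro t ht
    have hline : HasDerivAt (fun t : ℝ => x + t • w) w t := by
      simpa using ((hasDerivAt_id t).smul_const w).const_add x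
    have hcomp := (hf _ (hmem t ht)).hasFDerivAt.comp_hasDerivAt t hline
    have hlin : HasDerivAt (fun t : ℝ => t • fderiv ℝ f x w) (fderiv ℝ f x w) t := by
      simpa using (hasDerivAt_id t).smul_const (fderiv ℝ f x w)
    exact (hcomp.sub_const (f x)).sub hlin
  have hbound : ∀ t : ℝ, HasDerivAt (fun t : ℝ => θ / 2 * ‖w‖ ^ 2 * t ^ 2)
      (θ * ‖w‖ ^ 2 * t) t := by
    intro t
    exact ((hasDerivAt_pow 2 t).const_mul (θ / 2 * ‖w‖ ^ 2)).congr_deriv (by norm_num; ring)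
  have key := image_norm_le_of_norm_deriv_right_le_deriv_boundary
    (fun t ht => (hderiv t ht).continuousAt.continuousWithinAt)
    (fun t ht => (hderiv t (Set.Ico_subset_Icc_self ht)).hasDerivWithinAt)
    (by simp) hbound
    (fun t ht => by
      have h := hlip _ (hmem t (Set.Ico_subset_Icc_self ht))
      rw [add_sub_cancel_left, norm_smul, Real.norm_of_nonneg ht.1] at h
      calc ‖fderiv ℝ f (x + t • w) w - fderiv ℝ f x w‖
          ≤ ‖fderiv ℝ f (x + t • w) - fderiv ℝ f x‖ * ‖w‖ :=
            (fderiv ℝ f (x + t • w) - fderiv ℝ f x).le_opNorm w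
        _ ≤ θ * (t * ‖w‖) * ‖w‖ := by gcongr
        _ = θ * ‖w‖ ^ 2 * t := by ring)
    (Set.right_mem_Icc.2 zero_le_one)
  simpa [hw] using key


/-- Contraction estimate for the Newton step:
`‖N(u) − u*‖ ≤ (1/2)·‖u − u*‖` for `‖u − u*‖ ≤ min(ρ*/θ̄, 1/(2θρ*))`. -/
theorem newton_step_contraction_estimate {d : ℕ}
    (O : Set (EuclideanSpace ℝ (Fin d))) (hO : IsOpen O) (hOconv : Convex ℝ O)
    (f : EuclideanSpace ℝ (Fin d) → EuclideanSpace ℝ (Fin d))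
    (hdiff : ∀ u ∈ O, DifferentiableAt ℝ f u)
    (Dfinv : EuclideanSpace ℝ (Fin d) →
      (EuclideanSpace ℝ (Fin d) →L[ℝ] EuclideanSpace ℝ (Fin d)))
    (hinv_left : ∀ u ∈ O, (Dfinv u).comp (fderiv ℝ f u) =
      ContinuousLinearMap.id ℝ (EuclideanSpace ℝ (Fin d)))
    (hinv_right : ∀ u ∈ O, (fderiv ℝ f u).comp (Dfinv u) =
      ContinuousLinearMap.id ℝ (EuclideanSpace ℝ (Fin d)))
    (ustar : EuclideanSpace ℝ (Fin d)) (hustarO : ustar ∈ O) (hzero : f ustar = 0)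
    (θ θbar : ℝ) (hθ : 0 < θ) (hθbar : 0 < θbar)
    (hLipDf : ∀ u ∈ O, ∀ v ∈ O, ‖fderiv ℝ f u - fderiv ℝ f v‖ ≤ θ * ‖u - v‖)
    (hLipInv : ∀ u ∈ O, ∀ v ∈ O, ‖Dfinv u - Dfinv v‖ ≤ θbar * ‖u - v‖)
    (ρ : ℝ) (hρ : ρ = ‖Dfinv ustar‖) :
    ∀ u ∈ O, ‖u - ustar‖ ≤ min (ρ / θbar) (1 / (2 * θ * ρ)) →
      ‖(u - Dfinv u (f u)) - ustar‖ ≤ (1 / 2) * ‖u - ustar‖ := by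
  intro u hu hle
  obtain ⟨hle₁, hle₂⟩ := le_min_iff.1 hle
  have htaylor : ‖fderiv ℝ f u (u - ustar) - f u‖ ≤ θ / 2 * ‖u - ustar‖ ^ 2 := by
    have h := norm_sub_sub_fderiv_le_of_lipschitz hOconv hdiff hu hustarO
      (fun z hz => hLipDf z hz u hu)
    have heq : f ustar - f u - fderiv ℝ f u (ustar - u) =
        fderiv ℝ f u (u - ustar) - f u := by
      rw [hzero, map_sub, map_sub]
      abel
    rwa [heq, norm_sub_rev ustar u] at h
  have hinv : ‖Dfinv u‖ ≤ 2 * ρ := by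
    have hsmall : ‖u - ustar‖ * θbar ≤ ρ := (le_div_iff₀ hθbar).1 hle₁
    have htri : ‖Dfinv u‖ ≤ ‖Dfinv ustar‖ + ‖Dfinv u - Dfinv ustar‖ :=
      norm_le_norm_add_norm_sub' _ _
    linarith [hLipInv u hu ustar hustarO]
  have hstep : (u - Dfinv u (f u)) - ustar = Dfinv u (fderiv ℝ f u (u - ustar) - f u) := by
    have h := DFunLike.congr_fun (hinv_left u hu) (u - ustar)
    simp only [ContinuousLinearMap.comp_apply, ContinuousLinearMap.id_apply] at h
    rw [map_sub (Dfinv u), h]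
    abel
  have hρ₀ : 0 ≤ ρ := hρ ▸ norm_nonneg _
  have hradius : θ * ρ * ‖u - ustar‖ ≤ 1 / 2 := by
    rcases hρ₀.eq_or_lt with h | h
    · simp [← h]
    · have := (le_div_iff₀ (by positivity)).1 hle₂
      linarith
  calc ‖(u - Dfinv u (f u)) - ustar‖
      ≤ ‖Dfinv u‖ * ‖fderiv ℝ f u (u - ustar) - f u‖ := hstep ▸ (Dfinv u).le_opNorm _
    _ ≤ 2 * ρ * (θ / 2 * ‖u - ustar‖ ^ 2) := by gcongr
    _ = θ * ρ * ‖u - ustar‖ * ‖u - ustar‖ := by ring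
    _ ≤ 1 / 2 * ‖u - ustar‖ := by gcongr
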